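/- arXiv:1702.00422 — 4 statements merged into one kernel-verified Lean document; each statement's English description precedes it below -/
import Mathlib

section
/- Fix reals a1 > 0, b1 > 0, a2 > 0, b2 ≥ 0 with Ω := a1/b1 and an integer d ≥ 1. Let μ be a Borel probability measure on ℝ supported in [0, Ω], and set m_k := ∫ x^k dμ(x) for k = 0, 1, …, 2d. Assume μ is infinitesimally stationary for the logistic generator in the sense that ∫ (L x^k)(x) dμ(x) = 0 for every 1 ≤ k ≤ 2d−1, where (L x^k)(x) = ((x+1)^k − x^k)·λ1(x) + ((x−1)^k − x^k)·λ2(x). Let F ⊆ ℝ^{2d+1} (coordinates indexed 0,…,2d) be the set of vectors X such that: (i) X_0 = 1; (ii) Σ_{i=0}^{k+1} c_{k,i}·X_i = 0 for every 1 ≤ k ≤ 2d−1, where c_{k,i} is the coefficient of X^i in the polynomial p_k; (iii) the (d+1)×(d+1) matrix with (i,j) entry X_{i+j} (0 ≤ i,j ≤ d) is positive semidefinite; and (iv) the d×d matrices with (i,j) entries (0 ≤ i,j ≤ d−1) given by X_{i+j+1} and by Ω·X_{i+j} − X_{i+j+1}, respectively, are both positive semidefinite. Then the moment vector (m_0, m_1,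 …, m_{2d}) belongs to F, and consequently for every h ∈ ℝ^{2d+1}: sInf { Σ_{k=0}^{2d} h_k·X_k : X ∈ F } ≤ Σ_{k=0}^{2d} h_k·m_k ≤ sSup { Σ_{k=0}^{2d} h_k·X_k : X ∈ F }. -/
open MeasureTheory Polynomial

/-- The generator of the stochastic logistic model applied to the monomial `X^k`:
`p_k = ((X+1)^k − X^k)·(a1·X − b1·X²) + ((X−1)^k − X^k)·(a2·X + b2·X²)`. -/
noncomputable def logisticGenPoly (a1 b1 a2 b2 : ℝ) (k : ℕ) : Polynomial ℝ :=
  ((X + 1) ^ k - X ^ k) * (C a1 * X - C b1 * X ^ 2) +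
    ((X - 1) ^ k - X ^ k) * (C a2 * X + C b2 * X ^ 2)

/-- The feasible set of the static semidefinite program bounding the stationary moments
of the stochastic logistic model: vectors `Y = (Y_0, …, Y_{2d})` with `Y_0 = 1`, satisfying
the stationarity linear equations `Σ_i c_{k,i} Y_i = 0` (where `c_{k,i}` is the coefficient
of `X^i` in `p_k`; note `p_k` has degree at most `k+1 ≤ 2d`, so summing over all indices
`0 ≤ i ≤ 2d` captures exactly `Σ_{i=0}^{k+1} c_{k,i} Y_i`), the Hankel moment matrix
constraint, and the two localizing-matrix constraints for the state constraint
`0 ≤ x ≤ Ω`. -/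
def logisticSteadyFeasible (a1 b1 a2 b2 Ω : ℝ) (d : ℕ) : Set (Fin (2 * d + 1) → ℝ) :=
  {Y |
    Y 0 = 1 ∧
    (∀ k : ℕ, 1 ≤ k → k ≤ 2 * d - 1 →
      ∑ i : Fin (2 * d + 1), (logisticGenPoly a1 b1 a2 b2 k).coeff (i : ℕ) * Y i = 0) ∧
    Matrix.PosSemidef (Matrix.of fun i j : Fin (d + 1) =>
      Y ⟨(i : ℕ) + (j : ℕ), by have := i.isLt; have := j.isLt; omega⟩) ∧
    Matrix.PosSemidef (Matrix.of fun i j : Fin d =>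
      Y ⟨(i : ℕ) + (j : ℕ) + 1, by have := i.isLt; have := j.isLt; omega⟩) ∧
    Matrix.PosSemidef (Matrix.of fun i j : Fin d =>
      Ω * Y ⟨(i : ℕ) + (j : ℕ), by have := i.isLt; have := j.isLt; omega⟩ -
        Y ⟨(i : ℕ) + (j : ℕ) + 1, by have := i.isLt; have := j.isLt; omega⟩)}

lemma lgp_coeff (a1 b1 a2 b2 : ℝ) (k n : ℕ) :
    (logisticGenPoly a1 b1 a2 b2 k).coeff (n + 2) =
      (((X + 1 : ℝ[X]) ^ k - X ^ k).coeff (n + 1)) * a1 - (((X + 1 : ℝ[X]) ^ k - X ^ k).coeff n) * b1 +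
      ((((X - 1 : ℝ[X]) ^ k - X ^ k).coeff (n + 1)) * a2 +
        (((X - 1 : ℝ[X]) ^ k - X ^ k).coeff n) * b2) := by
  have e : logisticGenPoly a1 b1 a2 b2 k =
      (((X + 1 : ℝ[X]) ^ k - X ^ k) * C a1 * X ^ 1 - ((X + 1 : ℝ[X]) ^ k - X ^ k) * C b1 * X ^ 2) +
      (((X - 1 : ℝ[X]) ^ k - X ^ k) * C a2 * X ^ 1 +
        ((X - 1 : ℝ[X]) ^ k - X ^ k) * C b2 * X ^ 2) := by
    unfold logisticGenPoly; ring
  rw [e, coeff_add, coeff_sub, coeff_add, coeff_mul_X_pow, coeff_mul_X_pow,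
    show n + 2 = (n + 1) + 1 from rfl, coeff_mul_X_pow, coeff_mul_X_pow]
  simp only [coeff_mul_C]

lemma diff_plus_high (k n : ℕ) (h : k ≤ n) : ((X + 1 : ℝ[X]) ^ k - X ^ k).coeff n = 0 := by
  rw [coeff_sub, coeff_X_add_one_pow, coeff_X_pow]
  rcases h.eq_or_lt with rfl | h
  · simp
  · rw [Nat.choose_eq_zero_of_lt h, if_neg (by omega)]; simp

lemma diff_minus_high (k n : ℕ) (h : k ≤ n) : ((X - 1 : ℝ[X]) ^ k - X ^ k).coeff n = 0 := by
  rw [show (X - 1 : ℝ[X]) = X + C (-1) by simp [sub_eq_add_neg], coeff_sub, coeff_X_add_C_pow,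
    coeff_X_pow]
  rcases h.eq_or_lt with rfl | h
  · simp
  · rw [Nat.choose_eq_zero_of_lt h, if_neg (by omega)]; simp

lemma diff_plus_top (m : ℕ) : ((X + 1 : ℝ[X]) ^ (m + 1) - X ^ (m + 1)).coeff m = (m : ℝ) + 1 := by
  rw [coeff_sub, coeff_X_add_one_pow, coeff_X_pow]
  simp

lemma diff_minus_top (m : ℕ) : ((X - 1 : ℝ[X]) ^ (m + 1) - X ^ (m + 1)).coeff m = -((m : ℝ) + 1) := by
  rw [show (X - 1 : ℝ[X]) = X + C (-1) by simp [sub_eq_add_neg], coeff_sub, coeff_X_add_C_pow,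
    coeff_X_pow]
  simp

lemma lgp_top (a1 b1 a2 b2 : ℝ) (m : ℕ) :
    (logisticGenPoly a1 b1 a2 b2 (m + 1)).coeff (m + 2) = -((m + 1) * (b1 + b2)) := by
  rw [lgp_coeff, diff_plus_high _ _ le_rfl, diff_minus_high _ _ le_rfl, diff_plus_top,
    diff_minus_top]
  ring

lemma lgp_high (a1 b1 a2 b2 : ℝ) (k n : ℕ) (hk : 1 ≤ k) (h : k + 1 < n) :
    (logisticGenPoly a1 b1 a2 b2 k).coeff n = 0 := by
  obtain ⟨n, rfl⟩ : ∃ m, n = m + 2 := ⟨n - 2, by omega⟩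
  rw [lgp_coeff, diff_plus_high _ _ (by omega), diff_minus_high _ _ (by omega),
    diff_plus_high _ _ (by omega), diff_minus_high _ _ (by omega)]
  ring

lemma feasible_bdd (a1 b1 a2 b2 Ω : ℝ) (hb1 : 0 < b1) (hb2 : 0 ≤ b2) (d : ℕ) (hd : 1 ≤ d)
    (n : ℕ) : ∀ hn : n < 2 * d + 1,
    ∃ B : ℝ, ∀ Y ∈ logisticSteadyFeasible a1 b1 a2 b2 Ω d, |Y ⟨n, hn⟩| ≤ B := by
  induction n using Nat.strong_induction_on with
  | _ n ih =>
  intro hn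
  match n, ih, hn with
  | 0, ih, hn =>
    refine ⟨1, fun Y hY => ?_⟩
    have h0 : Y ⟨0, hn⟩ = 1 := hY.1
    rw [h0, abs_one]
  | 1, ih, hn =>
    refine ⟨|Ω|, fun Y hY => ?_⟩
    obtain ⟨h0, -, -, h3, h4⟩ := hY
    have h0 : Y ⟨0, by omega⟩ = 1 := h0
    have e3 := h3.diag_nonneg (i := ⟨0, hd⟩)
    have e4 := h4.diag_nonneg (i := ⟨0, hd⟩)
    simp only [Matrix.of_apply, add_zero, zero_add, h0] at e3 e4
    rw [abs_of_nonneg e3]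
    exact le_trans (by linarith) (le_abs_self Ω)
  | m + 2, ih, hn =>
    choose! B hB using ih
    set c : ℕ → ℝ := fun i => (logisticGenPoly a1 b1 a2 b2 (m + 1)).coeff i with hc
    refine ⟨(∑ i : Fin (2 * d + 1), |c i| * |B i|) / ((m + 1) * (b1 + b2)), fun Y hY => ?_⟩
    have hpos : 0 < ((m : ℝ) + 1) * (b1 + b2) := by positivity
    rw [le_div_iff₀ hpos]
    have hs := hY.2.1 (m + 1) (by omega) (by omega)
    rw [← Finset.add_sum_erase _ _ (Finset.mem_univ (⟨m + 2, hn⟩ : Fin (2 * d + 1)))] at hs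
    simp only [lgp_top] at hs
    have e : Y ⟨m + 2, hn⟩ * ((m + 1) * (b1 + b2)) =
        ∑ i ∈ Finset.univ.erase (⟨m + 2, hn⟩ : Fin (2 * d + 1)), c i * Y i := by
      simp only [hc]; linarith
    rw [← abs_of_pos hpos, ← abs_mul, e]
    refine (Finset.abs_sum_le_sum_abs _ _).trans ?_
    refine le_trans (Finset.sum_le_sum (g := fun i : Fin (2 * d + 1) => |c i| * |B i|) ?_)
      (Finset.sum_le_sum_of_subset_of_nonneg (Finset.erase_subset _ _)
        (fun i _ _ => by positivity))
    intro i hi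
    rw [abs_mul]
    have hne : (i : ℕ) ≠ m + 2 := fun h => (Finset.ne_of_mem_erase hi) (Fin.ext h)
    rcases lt_or_gt_of_ne hne with h | h
    · exact mul_le_mul_of_nonneg_left ((hB i h i.isLt Y hY).trans (le_abs_self _)) (abs_nonneg _)
    · simp only [hc, lgp_high a1 b1 a2 b2 (m + 1) i (by omega) (by omega)]
      simp

lemma functional_bdd (a1 b1 a2 b2 Ω : ℝ) (hb1 : 0 < b1) (hb2 : 0 ≤ b2) (d : ℕ) (hd : 1 ≤ d)
    (h : Fin (2 * d + 1) → ℝ) : ∃ M : ℝ, ∀ Y ∈ logisticSteadyFeasible a1 b1 a2 b2 Ω d,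
      |∑ k, h k * Y k| ≤ M := by
  choose B hB using fun i : Fin (2 * d + 1) =>
    feasible_bdd a1 b1 a2 b2 Ω hb1 hb2 d hd i i.isLt
  refine ⟨∑ i, |h i| * B i, fun Y hY => (Finset.abs_sum_le_sum_abs _ _).trans ?_⟩
  refine Finset.sum_le_sum fun i _ => ?_
  rw [abs_mul]
  exact mul_le_mul_of_nonneg_left (hB i Y hY) (abs_nonneg _)

lemma int_poly (μ : Measure ℝ) [IsProbabilityMeasure μ] (Ω : ℝ)
    (hsupp : ∀ᵐ x ∂μ, x ∈ Set.Icc (0 : ℝ) Ω) (f : ℝ → ℝ) (hf : Continuous f) :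
    Integrable f μ := by
  obtain ⟨M, hM⟩ := isCompact_Icc.exists_bound_of_continuousOn (hf.continuousOn (s := Set.Icc 0 Ω))
  exact Integrable.of_bound hf.aestronglyMeasurable M (hsupp.mono fun x hx => hM x hx)

lemma psd_aux (μ : Measure ℝ) [IsProbabilityMeasure μ] (Ω : ℝ)
    (hsupp : ∀ᵐ x ∂μ, x ∈ Set.Icc (0 : ℝ) Ω) (w : ℝ → ℝ) (hw : Continuous w)
    (hw0 : ∀ x ∈ Set.Icc (0 : ℝ) Ω, 0 ≤ w x) (n : ℕ) :
    Matrix.PosSemidef (Matrix.of fun i j : Fin n => ∫ x, w x * x ^ ((i : ℕ) + (j : ℕ)) ∂μ) := by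
  refine Matrix.PosSemidef.of_dotProduct_mulVec_nonneg ?_ ?_
  · ext i j
    simp [Matrix.conjTranspose_apply, add_comm]
  · intro c
    have e : star c ⬝ᵥ ((Matrix.of fun i j : Fin n =>
        ∫ x, w x * x ^ ((i : ℕ) + (j : ℕ)) ∂μ).mulVec c) =
        ∫ x, w x * (∑ i : Fin n, c i * x ^ (i : ℕ)) ^ 2 ∂μ := by
      have : ∀ x : ℝ, w x * (∑ i : Fin n, c i * x ^ (i : ℕ)) ^ 2 =
          ∑ i : Fin n, ∑ j : Fin n, c i * (c j * (w x * x ^ ((i : ℕ) + (j : ℕ)))) := by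
        intro x
        rw [sq, Finset.sum_mul_sum, Finset.mul_sum]
        refine Finset.sum_congr rfl fun i _ => ?_
        rw [Finset.mul_sum]
        refine Finset.sum_congr rfl fun j _ => ?_
        ring
      simp_rw [this]
      rw [integral_finsetSum _ (fun i _ => int_poly μ Ω hsupp _ (by fun_prop))]
      simp only [dotProduct, Matrix.mulVec, Matrix.of_apply, Pi.star_apply, star_trivial]
      refine Finset.sum_congr rfl fun i _ => ?_
      rw [integral_finsetSum _ (fun i _ => int_poly μ Ω hsupp _ (by fun_prop)), Finset.mul_sum]
      refine Finset.sum_congr rfl fun j _ => ?_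
      rw [integral_const_mul, integral_const_mul]
      ring
    rw [e]
    exact integral_nonneg_of_ae (hsupp.mono fun x hx => mul_nonneg (hw0 x hx) (sq_nonneg _))

/-- Steady-state moment bounds for the stochastic logistic model: if `μ` is a probability
measure supported in `[0, Ω]` (`Ω = a1/b1`) that is infinitesimally stationary for the
logistic generator, then its moment vector `(m_0, …, m_{2d})` is feasible for the static
semidefinite program, and consequently every linear functional of the moments is bounded
between the infimum and the supremum of that functional over the feasible set. -/
theorem logistic_steady_state_moment_bounds
    (a1 b1 a2 b2 : ℝ) (ha1 : 0 < a1) (hb1 : 0 < b1) (ha2 : 0 < a2) (hb2 : 0 ≤ b2)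
    (d : ℕ) (hd : 1 ≤ d)
    (μ : Measure ℝ) [IsProbabilityMeasure μ]
    (hsupp : ∀ᵐ x ∂μ, x ∈ Set.Icc (0 : ℝ) (a1 / b1))
    (hstat : ∀ k : ℕ, 1 ≤ k → k ≤ 2 * d - 1 →
      ∫ x, (((x + 1) ^ k - x ^ k) * (a1 * x - b1 * x ^ 2) +
            ((x - 1) ^ k - x ^ k) * (a2 * x + b2 * x ^ 2)) ∂μ = 0) :
    (fun k : Fin (2 * d + 1) => ∫ x, x ^ (k : ℕ) ∂μ) ∈
        logisticSteadyFeasible a1 b1 a2 b2 (a1 / b1) d ∧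
    ∀ h : Fin (2 * d + 1) → ℝ,
      sInf ((fun Y : Fin (2 * d + 1) → ℝ => ∑ k : Fin (2 * d + 1), h k * Y k) ''
          logisticSteadyFeasible a1 b1 a2 b2 (a1 / b1) d) ≤
        ∑ k : Fin (2 * d + 1), h k * ∫ x, x ^ (k : ℕ) ∂μ ∧
      ∑ k : Fin (2 * d + 1), h k * ∫ x, x ^ (k : ℕ) ∂μ ≤
        sSup ((fun Y : Fin (2 * d + 1) → ℝ => ∑ k : Fin (2 * d + 1), h k * Y k) ''
          logisticSteadyFeasible a1 b1 a2 b2 (a1 / b1) d) := by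
  have hI : ∀ f : ℝ → ℝ, Continuous f → Integrable f μ := int_poly μ _ hsupp
  have hmem : (fun k : Fin (2 * d + 1) => ∫ x, x ^ (k : ℕ) ∂μ) ∈
        logisticSteadyFeasible a1 b1 a2 b2 (a1 / b1) d := by
    refine ⟨by simp, ?_, ?_, ?_, ?_⟩
    · intro k hk1 hk2
      rw [← hstat k hk1 hk2]
      have hdeg : (logisticGenPoly a1 b1 a2 b2 k).natDegree < 2 * d + 1 := by
        rw [Nat.lt_succ_iff, natDegree_le_iff_coeff_eq_zero]
        intro n hn
        exact lgp_high _ _ _ _ _ _ hk1 (by omega)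
      have e : ∀ x : ℝ, (((x + 1) ^ k - x ^ k) * (a1 * x - b1 * x ^ 2) +
            ((x - 1) ^ k - x ^ k) * (a2 * x + b2 * x ^ 2)) =
          ∑ i : Fin (2 * d + 1), (logisticGenPoly a1 b1 a2 b2 k).coeff (i : ℕ) * x ^ (i : ℕ) := by
        intro x
        rw [Fin.sum_univ_eq_sum_range
          (fun i => (logisticGenPoly a1 b1 a2 b2 k).coeff i * x ^ i), ← eval_eq_sum_range' hdeg]
        simp [logisticGenPoly]
      simp_rw [e]
      rw [integral_finsetSum _ (fun i _ => hI _ (by fun_prop))]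
      simp_rw [integral_const_mul]
    · have := psd_aux μ _ hsupp (fun _ => 1) (by fun_prop) (fun _ _ => zero_le_one) (d + 1)
      simpa using this
    · have := psd_aux μ _ hsupp (fun x => x) (by fun_prop) (fun _ hx => hx.1) d
      simpa [pow_succ'] using this
    · have := psd_aux μ _ hsupp (fun x => a1 / b1 - x) (by fun_prop)
        (fun _ hx => sub_nonneg.2 hx.2) d
      convert this using 4 with i j
      rw [← integral_const_mul, ← integral_sub (hI _ (by fun_prop)) (hI _ (by fun_prop))]
      congr 1
      ext x
      ring
  refine ⟨hmem, fun h => ?_⟩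
  obtain ⟨M, hM⟩ := functional_bdd a1 b1 a2 b2 (a1 / b1) hb1 hb2 d hd h
  constructor
  · refine csInf_le ⟨-M, ?_⟩ ⟨_, hmem, rfl⟩
    rintro _ ⟨Y, hY, rfl⟩
    exact (abs_le.1 (hM Y hY)).1
  · refine le_csSup ⟨M, ?_⟩ ⟨_, hmem, rfl⟩
    rintro _ ⟨Y, hY, rfl⟩
    exact (abs_le.1 (hM Y hY)).2
end

section
/- Let (S, 𝒜, μ) be a measure space with μ a finite measure, let d be a positive integer, and let x : S → ℝ be measurable with x(s) ≥ 0 for μ-almost every s and with s ↦ x(s)^k integrable for every 0 ≤ k ≤ 2d−1. Then the d×d matrix with entries ∫ x(s)^{i+j+1} dμ(s), for 0 ≤ i, j ≤ d−1, is positive semidefinite. -/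
open MeasureTheory

/-- Lower localizing-matrix constraint: if `x ≥ 0` almost surely, then the matrix of
moments `∫ x^{i+j+1}` is positive semidefinite. -/
theorem localizing_matrix_nonneg_posSemidef
    {S : Type*} [MeasurableSpace S] (μ : Measure S) [IsFiniteMeasure μ]
    (d : ℕ) (hd : 0 < d) (x : S → ℝ) (hx : Measurable x)
    (hxnn : ∀ᵐ s ∂μ, 0 ≤ x s)
    (hint : ∀ k ≤ 2 * d - 1, Integrable (fun s => x s ^ k) μ) :
    Matrix.PosSemidef
      (Matrix.of fun i j : Fin d => ∫ s, x s ^ ((i : ℕ) + (j : ℕ) + 1) ∂μ) := by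
  have hI : ∀ i j : Fin d, Integrable (fun s => x s ^ ((i : ℕ) + (j : ℕ) + 1)) μ := by
    intro i j
    apply hint
    have := i.2
    have := j.2
    omega
  refine Matrix.PosSemidef.of_dotProduct_mulVec_nonneg ?_ ?_
  · ext i j
    simp [Matrix.conjTranspose_apply, add_comm (i : ℕ) (j : ℕ)]
  · intro c
    have key : star c ⬝ᵥ (Matrix.of fun i j : Fin d =>
        ∫ s, x s ^ ((i : ℕ) + (j : ℕ) + 1) ∂μ).mulVec c
        = ∫ s, x s * (∑ i : Fin d, c i * x s ^ (i : ℕ)) ^ 2 ∂μ := by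
      have h1 : ∀ s, x s * (∑ i : Fin d, c i * x s ^ (i : ℕ)) ^ 2
          = ∑ i : Fin d, ∑ j : Fin d, (c i * c j) * x s ^ ((i : ℕ) + (j : ℕ) + 1) := by
        intro s
        rw [sq, Finset.sum_mul_sum, Finset.mul_sum]
        refine Finset.sum_congr rfl fun i _ => ?_
        rw [Finset.mul_sum]
        refine Finset.sum_congr rfl fun j _ => ?_
        ring
      simp_rw [h1]
      rw [integral_finsetSum _ fun i _ => integrable_finsetSum _ fun j _ =>
        (hI i j).const_mul _]
      simp only [dotProduct, Matrix.mulVec, Matrix.of_apply, Pi.star_apply, star_trivial]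
      refine Finset.sum_congr rfl fun i _ => ?_
      rw [integral_finsetSum _ fun j _ => (hI i j).const_mul _, Finset.mul_sum]
      refine Finset.sum_congr rfl fun j _ => ?_
      rw [integral_const_mul]
      ring
    rw [key]
    apply integral_nonneg_of_ae
    filter_upwards [hxnn] with s hs
    exact mul_nonneg hs (sq_nonneg _)
end

section
/- Let (S, 𝒜, μ) be a measure space with μ a finite measure, let d be a positive integer, let Ω be a real number, and let x : S → ℝ be measurable with x(s) ≤ Ω for μ-almost every s and with s ↦ x(s)^k integrable for every 0 ≤ k ≤ 2d−1. Then the d×d matrix with entries ∫ (Ω − x(s)) · x(s)^{i+j} dμ(s), for 0 ≤ i, j ≤ d−1, is positive semidefinite. -/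
open MeasureTheory

/-- Upper localizing-matrix constraint: if `x ≤ Ω` almost surely, then the matrix of
moments `∫ (Ω − x)·x^{i+j}` is positive semidefinite. -/
theorem localizing_matrix_upper_posSemidef
    {S : Type*} [MeasurableSpace S] (μ : Measure S) [IsFiniteMeasure μ]
    (d : ℕ) (hd : 0 < d) (Ω : ℝ) (x : S → ℝ) (hx : Measurable x)
    (hxle : ∀ᵐ s ∂μ, x s ≤ Ω)
    (hint : ∀ k ≤ 2 * d - 1, Integrable (fun s => x s ^ k) μ) :
    Matrix.PosSemidef
      (Matrix.of fun i j : Fin d => ∫ s, (Ω - x s) * x s ^ ((i : ℕ) + (j : ℕ)) ∂μ) := by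
  have hI : ∀ i j : Fin d,
      Integrable (fun s => (Ω - x s) * x s ^ ((i : ℕ) + (j : ℕ))) μ := by
    intro i j
    have h1 := (hint ((i : ℕ) + j) (by omega)).const_mul Ω
    have h2 := hint ((i : ℕ) + j + 1) (by omega)
    refine (h1.sub h2).congr (Filter.Eventually.of_forall fun s => ?_)
    simp only [Pi.sub_apply]
    ring
  refine ⟨?_, fun c => ?_⟩
  · ext i j
    simp [Matrix.conjTranspose_apply, add_comm]
  · simp only [Finsupp.sum, Matrix.of_apply, star_trivial]
    have key : ∑ i ∈ c.support, ∑ j ∈ c.support,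
        c i * (∫ s, (Ω - x s) * x s ^ ((i : ℕ) + (j : ℕ)) ∂μ) * c j
        = ∫ s, (Ω - x s) * (∑ i ∈ c.support, c i * x s ^ (i : ℕ)) ^ 2 ∂μ := by
      have h : ∀ s, (Ω - x s) * (∑ i ∈ c.support, c i * x s ^ (i : ℕ)) ^ 2
          = ∑ i ∈ c.support, ∑ j ∈ c.support,
            c i * ((Ω - x s) * x s ^ ((i : ℕ) + (j : ℕ))) * c j := by
        intro s
        rw [sq, Finset.sum_mul_sum, Finset.mul_sum]
        refine Finset.sum_congr rfl fun i _ => ?_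
        rw [Finset.mul_sum]
        refine Finset.sum_congr rfl fun j _ => ?_
        ring
      simp_rw [h]
      rw [integral_finsetSum _ fun i _ => integrable_finsetSum _ fun j _ =>
        ((hI i j).const_mul (c i)).mul_const (c j)]
      refine Finset.sum_congr rfl fun i _ => ?_
      rw [integral_finsetSum _ fun j _ => ((hI i j).const_mul (c i)).mul_const (c j)]
      refine Finset.sum_congr rfl fun j _ => ?_
      rw [integral_mul_const, integral_const_mul]
    rw [key]
    refine integral_nonneg_of_ae ?_
    filter_upwards [hxle] with s hs
    exact mul_nonneg (sub_nonneg.2 hs) (sq_nonneg _)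
end

section
/- Let a1, b1, a2, b2 be real numbers and let k ≥ 1 be a natural number. Consider the real polynomial p_k := ((X+1)^k − X^k)·(a1·X − b1·X²) + ((X−1)^k − X^k)·(a2·X + b2·X²). Then: (i) the coefficient of X^{k+2} in p_k is zero, so deg p_k ≤ k + 1; (ii) the coefficient of X^{k+1} in p_k equals −k·(b1 + b2); and (iii) if b1 + b2 ≠ 0, then the natural degree of p_k is exactly k + 1. -/
open Polynomial

theorem logisticAux_coeff (a1 b1 a2 b2 : ℝ) (k j : ℕ) :
    (logisticGenPoly a1 b1 a2 b2 k).coeff (j + 2) =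
      a1 * (((X + C 1 : ℝ[X]) ^ k).coeff (j + 1) - (X ^ k : ℝ[X]).coeff (j + 1))
      - b1 * (((X + C 1 : ℝ[X]) ^ k).coeff j - (X ^ k : ℝ[X]).coeff j)
      + a2 * (((X + C (-1) : ℝ[X]) ^ k).coeff (j + 1) - (X ^ k : ℝ[X]).coeff (j + 1))
      + b2 * (((X + C (-1) : ℝ[X]) ^ k).coeff j - (X ^ k : ℝ[X]).coeff j) := by
  have h : logisticGenPoly a1 b1 a2 b2 k =
      C a1 * (((X + C 1 : ℝ[X]) ^ k - X ^ k) * X ^ 1)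
      - C b1 * (((X + C 1 : ℝ[X]) ^ k - X ^ k) * X ^ 2)
      + C a2 * (((X + C (-1) : ℝ[X]) ^ k - X ^ k) * X ^ 1)
      + C b2 * (((X + C (-1) : ℝ[X]) ^ k - X ^ k) * X ^ 2) := by
    have e : (X + C (-1) : ℝ[X]) = X - 1 := by simp [sub_eq_add_neg]
    rw [e, C_1]
    unfold logisticGenPoly
    ring
  have e1 : ∀ q : ℝ[X], (q * X ^ 1).coeff (j + 2) = q.coeff (j + 1) := fun q =>
    coeff_mul_X_pow q 1 (j + 1)
  rw [h]
  simp only [coeff_add, coeff_sub, coeff_C_mul, e1, coeff_mul_X_pow]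

theorem logisticAux_zero (a1 b1 a2 b2 : ℝ) (k j : ℕ) (hj : k ≤ j) :
    (logisticGenPoly a1 b1 a2 b2 k).coeff (j + 2) = 0 := by
  rw [logisticAux_coeff]
  simp only [coeff_X_add_C_pow, coeff_X_pow]
  rcases hj.eq_or_lt with rfl | hj
  · simp
  · have h1 : k.choose j = 0 := Nat.choose_eq_zero_of_lt hj
    have h2 : k.choose (j + 1) = 0 := Nat.choose_eq_zero_of_lt (by omega)
    have h3 : j ≠ k := by omega
    have h4 : j + 1 ≠ k := by omega
    simp [h1, h2, h3, h4]

/-- For `k ≥ 1`, the polynomial `p_k = L(X^k)` of the stochastic logistic model has zero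
coefficient at degree `k + 2` (so degree at most `k + 1`), coefficient `−k·(b1 + b2)` at
degree `k + 1`, and, if `b1 + b2 ≠ 0`, natural degree exactly `k + 1`. -/
theorem logisticGenPoly_degree (a1 b1 a2 b2 : ℝ) (k : ℕ) (hk : 1 ≤ k) :
    (logisticGenPoly a1 b1 a2 b2 k).coeff (k + 2) = 0 ∧
    (logisticGenPoly a1 b1 a2 b2 k).degree ≤ (k + 1 : ℕ) ∧
    (logisticGenPoly a1 b1 a2 b2 k).coeff (k + 1) = -(k : ℝ) * (b1 + b2) ∧
    (b1 + b2 ≠ 0 → (logisticGenPoly a1 b1 a2 b2 k).natDegree = k + 1) := by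
  have hd : (logisticGenPoly a1 b1 a2 b2 k).degree ≤ (k + 1 : ℕ) := by
    rw [degree_le_iff_coeff_zero]
    intro m hm
    have hm' : k + 1 < m := by exact_mod_cast hm
    obtain ⟨j, rfl⟩ : ∃ j, m = j + 2 := ⟨m - 2, by omega⟩
    exact logisticAux_zero a1 b1 a2 b2 k j (by omega)
  have hc : (logisticGenPoly a1 b1 a2 b2 k).coeff (k + 1) = -(k : ℝ) * (b1 + b2) := by
    obtain ⟨n, rfl⟩ : ∃ n, k = n + 1 := ⟨k - 1, by omega⟩
    have h := logisticAux_coeff a1 b1 a2 b2 (n + 1) n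
    simp only [coeff_X_add_C_pow, coeff_X_pow] at h
    rw [show n + 1 + 1 = n + 2 from rfl, h]
    simp
    ring
  refine ⟨logisticAux_zero a1 b1 a2 b2 k k le_rfl, hd, hc, fun hb => ?_⟩
  apply le_antisymm (natDegree_le_of_degree_le hd)
  apply le_natDegree_of_ne_zero
  rw [hc]
  exact mul_ne_zero (neg_ne_zero.mpr (by exact_mod_cast (by omega : k ≠ 0))) hb
end
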